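/- arXiv:2109.13564 — 2 statements merged into one kernel-verified Lean document; each statement's English description precedes it below -/
import Mathlib

section
/- Let n ≥ 3 and let G_1,…,G_n be connected finite simple graphs on pairwise disjoint vertex sets, each with at least two vertices, with chosen vertices x_i ∈ V(G_i), and let G be the circuit of G_1,…,G_n with respect to the vertices x_i. Then ABC_GG(G) < (|E(G)| − n) + Σ_{i=1}^{n} ABC_GG(G_i) + √((|V(G)| − 2)/(|V(G_1)|·|V(G_n)|)) + Σ_{i=1}^{n−1} √((|V(G)| − 2)/(|V(G_i)|·|V(G_{i+1})|)). -/
open Finset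

/-- The atom-bond connectivity index `ABC(G)`. -/
noncomputable def abcIndex {V : Type*} [Fintype V] (G : SimpleGraph V) : ℝ := by
  classical
  exact ∑ e ∈ G.edgeFinset,
    Sym2.lift ⟨fun u v =>
      Real.sqrt (((G.degree u : ℝ) + (G.degree v : ℝ) - 2) /
        ((G.degree u : ℝ) * (G.degree v : ℝ))),
      fun u v => congrArg Real.sqrt (by ring)⟩ e

/-- `nClose G u v` is the number of vertices reachable from `u` that are strictly
closer to `u` than to `v`. -/
noncomputable def nClose {V : Type*} (G : SimpleGraph V) (u v : V) : ℕ :=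
  Nat.card {w : V | G.Reachable u w ∧ G.dist w u < G.dist w v}

/-- The Graovac–Ghorbani index `ABC_GG(G)`. -/
noncomputable def abcggIndex {V : Type*} [Fintype V] (G : SimpleGraph V) : ℝ := by
  classical
  exact ∑ e ∈ G.edgeFinset,
    Sym2.lift ⟨fun u v =>
      Real.sqrt (((nClose G u v : ℝ) + (nClose G v u : ℝ) - 2) /
        ((nClose G u v : ℝ) * (nClose G v u : ℝ))),
      fun u v => congrArg Real.sqrt (by ring)⟩ e

/-- The degree of a vertex, as a real number. -/
noncomputable def degR {V : Type*} [Fintype V] (G : SimpleGraph V) (v : V) : ℝ := by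
  classical
  exact (G.degree v : ℝ)

/-- The circuit of the graphs `G i` with respect to the vertices `x i`:
the disjoint union of the `G i` together with the cycle edges
`x i — x (i+1)` and `x (k-1) — x 0`. -/
def circuitGraph {k : ℕ} {V : Fin k → Type*} (G : ∀ i, SimpleGraph (V i)) (x : ∀ i, V i) :
    SimpleGraph (Σ i, V i) :=
  SimpleGraph.fromRel (fun p q =>
    (∃ (i : Fin k) (a b : V i), p = ⟨i, a⟩ ∧ q = ⟨i, b⟩ ∧ (G i).Adj a b) ∨
    (∃ (i : Fin k) (h : i.1 + 1 < k),
      p = ⟨i, x i⟩ ∧ q = ⟨⟨i.1 + 1, h⟩, x ⟨i.1 + 1, h⟩⟩) ∨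
    (∃ (h : 0 < k),
      p = ⟨⟨k - 1, Nat.sub_lt h Nat.one_pos⟩, x ⟨k - 1, Nat.sub_lt h Nat.one_pos⟩⟩ ∧
      q = ⟨⟨0, h⟩, x ⟨0, h⟩⟩))

def idxLow {k : ℕ} (j : Fin (k - 1)) : Fin k := ⟨j.1, by have := j.2; omega⟩
def idxHigh {k : ℕ} (j : Fin (k - 1)) : Fin k := ⟨j.1 + 1, by have := j.2; omega⟩

/-- The contribution of an edge to the Graovac–Ghorbani index. -/
noncomputable def abcggWeight {V : Type*} (G : SimpleGraph V) : Sym2 V → ℝ :=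
  Sym2.lift ⟨fun u v =>
      Real.sqrt (((nClose G u v : ℝ) + (nClose G v u : ℝ) - 2) /
        ((nClose G u v : ℝ) * (nClose G v u : ℝ))),
      fun u v => congrArg Real.sqrt (by ring)⟩

theorem abcggWeight_mk {V : Type*} (G : SimpleGraph V) (u v : V) :
    abcggWeight G s(u, v) = Real.sqrt (((nClose G u v : ℝ) + (nClose G v u : ℝ) - 2) /
        ((nClose G u v : ℝ) * (nClose G v u : ℝ))) := rfl

theorem abcggIndex_eq_sum {V : Type*} [Fintype V] (G : SimpleGraph V) [Fintype G.edgeSet] :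
    abcggIndex G = ∑ e ∈ G.edgeFinset, abcggWeight G e := by
  unfold abcggIndex abcggWeight
  congr!

theorem abcggWeight_nonneg {V : Type*} (G : SimpleGraph V) (e : Sym2 V) :
    0 ≤ abcggWeight G e := by
  induction e with
  | _ u v => exact Real.sqrt_nonneg _

theorem abcggWeight_lt_one {V : Type*} (G : SimpleGraph V) (e : Sym2 V) :
    abcggWeight G e < 1 := by
  induction e with
  | _ u v =>
    rw [abcggWeight_mk, Real.sqrt_lt' one_pos]
    rcases Nat.eq_zero_or_pos (nClose G u v) with ha | ha
    · simp [ha]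
    rcases Nat.eq_zero_or_pos (nClose G v u) with hb | hb
    · simp [hb]
    have ha' : (1 : ℝ) ≤ nClose G u v := by exact_mod_cast ha
    have hb' : (1 : ℝ) ≤ nClose G v u := by exact_mod_cast hb
    rw [div_lt_iff₀ (by positivity)]
    nlinarith [mul_nonneg (sub_nonneg.2 ha') (sub_nonneg.2 hb')]

theorem abcggIndex_nonneg {V : Type*} [Fintype V] (G : SimpleGraph V) : 0 ≤ abcggIndex G := by
  classical
  rw [abcggIndex_eq_sum]
  exact Finset.sum_nonneg fun e _ => abcggWeight_nonneg G e

theorem nClose_add_nClose_le {V : Type*} [Fintype V] (G : SimpleGraph V) (u v : V) :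
    nClose G u v + nClose G v u ≤ Fintype.card V := by
  unfold nClose
  rw [Nat.card_coe_set_eq, Nat.card_coe_set_eq, ← Set.ncard_union_eq, ← Nat.card_eq_fintype_card]
  · exact Set.ncard_le_card _
  · rw [Set.disjoint_left]
    rintro w ⟨-, h⟩ ⟨-, h'⟩
    exact lt_asymm h h'

theorem abcggWeight_le_of_le_nClose {V : Type*} [Fintype V] (G : SimpleGraph V) {u v : V}
    {a b : ℕ} (ha : 0 < a) (hb : 0 < b) (hab : 2 ≤ a + b)
    (hau : a ≤ nClose G u v) (hbv : b ≤ nClose G v u) :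
    abcggWeight G s(u, v) ≤ Real.sqrt (((Fintype.card V : ℝ) - 2) / ((a : ℝ) * (b : ℝ))) := by
  rw [abcggWeight_mk]
  have hsum : (nClose G u v : ℝ) + nClose G v u ≤ Fintype.card V := by
    exact_mod_cast nClose_add_nClose_le G u v
  have hau' : (a : ℝ) ≤ nClose G u v := by exact_mod_cast hau
  have hbv' : (b : ℝ) ≤ nClose G v u := by exact_mod_cast hbv
  have hab' : (2 : ℝ) ≤ a + b := by exact_mod_cast hab
  have ha' : (0 : ℝ) < a := by exact_mod_cast ha
  have hb' : (0 : ℝ) < b := by exact_mod_cast hb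
  apply Real.sqrt_le_sqrt
  apply div_le_div₀
  · linarith
  · linarith
  · positivity
  · gcongr

section Circuit

variable {k : ℕ} {V : Fin k → Type*} {G : ∀ i, SimpleGraph (V i)} {x : ∀ i, V i}

theorem circuitGraph_adj_of_adj {i : Fin k} {a b : V i} (h : (G i).Adj a b) :
    (circuitGraph G x).Adj ⟨i, a⟩ ⟨i, b⟩ := by
  rw [circuitGraph, SimpleGraph.fromRel_adj]
  refine ⟨fun e => h.ne (by simpa using e), Or.inl (Or.inl ⟨i, a, b, rfl, rfl, h⟩)⟩

theorem eq_of_circuitGraph_adj_of_fst_ne {p q : Σ i, V i} (h : (circuitGraph G x).Adj p q)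
    (hne : p.1 ≠ q.1) : p = ⟨p.1, x p.1⟩ := by
  rw [circuitGraph, SimpleGraph.fromRel_adj] at h
  obtain ⟨-, (⟨i, a, b, rfl, rfl, -⟩ | ⟨i, hi, rfl, rfl⟩ | ⟨hk, rfl, rfl⟩) |
    (⟨i, a, b, rfl, rfl, -⟩ | ⟨i, hi, rfl, rfl⟩ | ⟨hk, rfl, rfl⟩)⟩ := h
  all_goals first | rfl | exact absurd rfl hne

theorem exists_walk_length_lt_of_fst_ne {p q : Σ i, V i} (w : (circuitGraph G x).Walk p q)
    (hne : p.1 ≠ q.1) :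
    ∃ w' : (circuitGraph G x).Walk p ⟨p.1, x p.1⟩, w'.length < w.length := by
  induction w with
  | nil => exact absurd rfl hne
  | @cons p r q h w ih =>
    by_cases hpr : p.1 = r.1
    · obtain ⟨w', hw'⟩ := ih (hpr ▸ hne)
      have he : (⟨r.1, x r.1⟩ : Σ i, V i) = ⟨p.1, x p.1⟩ := by rw [hpr]
      exact ⟨.cons h (w'.copy rfl he), by simpa using hw'⟩
    · have hp := eq_of_circuitGraph_adj_of_fst_ne h hpr
      exact ⟨SimpleGraph.Walk.nil.copy rfl hp, by simp⟩

theorem card_le_nClose_circuitGraph [∀ i, Fintype (V i)] {i j : Fin k} (hij : i ≠ j)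
    (hconn : (G i).Connected) (hadj : (circuitGraph G x).Adj ⟨i, x i⟩ ⟨j, x j⟩) :
    Fintype.card (V i) ≤ nClose (circuitGraph G x) ⟨i, x i⟩ ⟨j, x j⟩ := by
  have hreach (a : V i) : (circuitGraph G x).Reachable ⟨i, x i⟩ ⟨i, a⟩ :=
    (hconn.preconnected (x i) a).map
      (⟨fun b => ⟨i, b⟩, circuitGraph_adj_of_adj⟩ : G i →g circuitGraph G x)
  rw [← Nat.card_eq_fintype_card]
  refine Nat.card_le_card_of_injective (fun a => ⟨⟨i, a⟩, hreach a, ?_⟩) fun a b h => ?_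
  · obtain ⟨w, hw⟩ := ((hreach a).symm.trans hadj.reachable).exists_walk_length_eq_dist
    obtain ⟨w', hw'⟩ := exists_walk_length_lt_of_fst_ne w hij
    exact (SimpleGraph.dist_le w').trans_lt (hw ▸ hw')
  · simpa using h

theorem abcggWeight_circuitGraph_le [∀ i, Fintype (V i)] {i j : Fin k} (hij : i ≠ j)
    (hconn : ∀ i, (G i).Connected) (hadj : (circuitGraph G x).Adj ⟨i, x i⟩ ⟨j, x j⟩) :
    abcggWeight (circuitGraph G x) s(⟨i, x i⟩, ⟨j, x j⟩) ≤
      Real.sqrt (((Fintype.card (Σ i, V i) : ℝ) - 2) /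
        ((Fintype.card (V i) : ℝ) * (Fintype.card (V j) : ℝ))) := by
  have hi : 0 < Fintype.card (V i) := Fintype.card_pos_iff.2 ⟨x i⟩
  have hj : 0 < Fintype.card (V j) := Fintype.card_pos_iff.2 ⟨x j⟩
  exact abcggWeight_le_of_le_nClose _ hi hj (by omega)
    (card_le_nClose_circuitGraph hij (hconn i) hadj)
    (card_le_nClose_circuitGraph hij.symm (hconn j) hadj.symm)

theorem circuitGraph_adj_idxLow_idxHigh (j : Fin (k - 1)) :
    (circuitGraph G x).Adj ⟨idxLow j, x (idxLow j)⟩ ⟨idxHigh j, x (idxHigh j)⟩ := by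
  rw [circuitGraph, SimpleGraph.fromRel_adj]
  refine ⟨fun e => ?_, Or.inl (Or.inr (Or.inl ⟨idxLow j, (idxHigh j).2, rfl, rfl⟩))⟩
  have := congrArg (fun p => (Sigma.fst p).1) e
  simp [idxLow, idxHigh] at this

theorem circuitGraph_adj_zero_last (hk : 2 ≤ k) :
    (circuitGraph G x).Adj ⟨⟨0, by omega⟩, x ⟨0, by omega⟩⟩
      ⟨⟨k - 1, by omega⟩, x ⟨k - 1, by omega⟩⟩ := by
  rw [circuitGraph, SimpleGraph.fromRel_adj]
  refine ⟨fun e => ?_, Or.inr (Or.inr (Or.inr ⟨by omega, rfl, rfl⟩))⟩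
  have := congrArg (fun p => (Sigma.fst p).1) e
  simp only at this
  omega

end Circuit

theorem abcgg_circuitGraph_upper {n : ℕ} (hn : 3 ≤ n) {V : Fin n → Type*} [∀ i, Fintype (V i)]
    (G : ∀ i, SimpleGraph (V i)) (x : ∀ i, V i)
    (hconn : ∀ i, (G i).Connected) (hcard : ∀ i, 2 ≤ Fintype.card (V i)) :
    abcggIndex (circuitGraph G x) <
      ((Nat.card (circuitGraph G x).edgeSet : ℝ) - (n : ℝ)) +
      (∑ i, abcggIndex (G i)) +
      Real.sqrt (((Fintype.card (Σ i, V i) : ℝ) - 2) /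
        ((Fintype.card (V ⟨0, by omega⟩) : ℝ) * (Fintype.card (V ⟨n - 1, by omega⟩) : ℝ))) +
      ∑ j : Fin (n - 1),
        Real.sqrt (((Fintype.card (Σ i, V i) : ℝ) - 2) /
          ((Fintype.card (V (idxLow j)) : ℝ) * (Fintype.card (V (idxHigh j)) : ℝ))) := by
  classical
  have h0 : 0 < n := by omega
  have hl : n - 1 < n := by omega
  set H := circuitGraph G x
  set c : Fin (n - 1) → Sym2 (Σ i, V i) := fun j =>
    s(⟨idxLow j, x (idxLow j)⟩, ⟨idxHigh j, x (idxHigh j)⟩)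
  set d : Sym2 (Σ i, V i) := s(⟨⟨0, h0⟩, x ⟨0, h0⟩⟩, ⟨⟨n - 1, hl⟩, x ⟨n - 1, hl⟩⟩)
  have hfst {p q r s : Σ i, V i} (h : s(p, q) = s(r, s)) :
      p.1.1 = r.1.1 ∧ q.1.1 = s.1.1 ∨ p.1.1 = s.1.1 ∧ q.1.1 = r.1.1 := by
    rcases Sym2.eq_iff.1 h with ⟨rfl, rfl⟩ | ⟨rfl, rfl⟩ <;> simp
  have hcinj : Function.Injective c := by
    intro i j hij
    have := hfst hij
    simp only [idxLow, idxHigh] at this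
    ext
    omega
  have hdc : d ∉ univ.image c := by
    intro h
    obtain ⟨j, -, hj⟩ := Finset.mem_image.1 h
    have := hfst hj
    simp only [idxLow, idxHigh] at this
    omega
  set C := insert d (univ.image c) with hC
  have hCcard : C.card = n := by
    rw [hC, Finset.card_insert_of_notMem hdc, Finset.card_image_of_injective _ hcinj]
    simp only [Finset.card_univ, Fintype.card_fin]
    omega
  have hCsub : C ⊆ H.edgeFinset := by
    rw [hC, Finset.insert_subset_iff, Finset.image_subset_iff]
    refine ⟨?_, fun j _ => ?_⟩
    · exact SimpleGraph.mem_edgeFinset.2 (circuitGraph_adj_zero_last (by omega))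
    · exact SimpleGraph.mem_edgeFinset.2 (circuitGraph_adj_idxLow_idxHigh j)
  have hne : (H.edgeFinset \ C).Nonempty := by
    have : Nontrivial (V ⟨0, h0⟩) := Fintype.one_lt_card_iff_nontrivial.1 (hcard _)
    obtain ⟨b, hb⟩ := (hconn ⟨0, h0⟩).preconnected.exists_adj_of_nontrivial (x ⟨0, h0⟩)
    refine ⟨s(⟨_, x ⟨0, h0⟩⟩, ⟨_, b⟩), Finset.mem_sdiff.2
      ⟨SimpleGraph.mem_edgeFinset.2 (circuitGraph_adj_of_adj hb), fun h => ?_⟩⟩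
    rcases Finset.mem_insert.1 h with h | h
    · have := hfst h
      simp only at this
      omega
    · obtain ⟨j, -, hj⟩ := Finset.mem_image.1 h
      have := hfst hj
      simp only [idxLow, idxHigh] at this
      omega
  have hinner : ∑ e ∈ H.edgeFinset \ C, abcggWeight H e < (Nat.card H.edgeSet : ℝ) - n := by
    refine (Finset.sum_lt_sum_of_nonempty hne fun e _ => abcggWeight_lt_one H e).trans_eq ?_
    rw [Finset.sum_const, nsmul_one, Finset.cast_card_sdiff hCsub, hCcard,
      Nat.card_eq_fintype_card, SimpleGraph.edgeFinset_card]
  have hcycle : ∑ e ∈ C, abcggWeight H e = abcggWeight H d + ∑ j, abcggWeight H (c j) := by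
    rw [hC, Finset.sum_insert hdc, Finset.sum_image fun i _ j _ h => hcinj h]
  have hlast := abcggWeight_circuitGraph_le (by simp; omega) hconn
    (circuitGraph_adj_zero_last (G := G) (x := x) (by omega))
  have hpath := Finset.sum_le_sum fun (j : Fin (n - 1)) (_ : j ∈ univ) =>
    abcggWeight_circuitGraph_le (by simp [idxLow, idxHigh]) hconn
      (circuitGraph_adj_idxLow_idxHigh (G := G) (x := x) j)
  have hpieces : 0 ≤ ∑ i, abcggIndex (G i) := Finset.sum_nonneg fun i _ => abcggIndex_nonneg _
  rw [abcggIndex_eq_sum, ← Finset.sum_sdiff hCsub, hcycle]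
  linarith
end

section
/- Let O_n be the ortho-chain square cactus of order n. (i) For every k ≥ 1: if n = 2k then ABC_GG(O_n) = 2k√2 + 4·Σ_{i=1}^{k} √((6k−1)/((6k−3i+2)(3i−1))), and if n = 2k+1 then ABC_GG(O_n) = (2k+1)√2 + 2√(6k+2)/(3k+2) + 4·Σ_{i=1}^{k} √((6k+2)/((6k−3i+5)(3i−1))). (ii) For every n ≥ 2, ABC(O_n) = (3n+2)/√2 + (n−2)·√6/4. -/
open Finset

/-- The ortho-chain square cactus `O n`: vertices `c 0, …, c n` (`Sum.inl`) and
`r 1, …, r n`, `s 1, …, s n` (`Sum.inr`), the `i`-th square having edges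
`c (i-1) — c i`, `c i — r i`, `r i — s i` and `s i — c (i-1)`. -/
def orthoChainSquare (n : ℕ) : SimpleGraph (Fin (n + 1) ⊕ Fin n ⊕ Fin n) :=
  SimpleGraph.fromRel (fun p q =>
    ∃ j : Fin n,
      (p = Sum.inl j.castSucc ∧ q = Sum.inl j.succ) ∨
      (p = Sum.inl j.succ ∧ q = Sum.inr (Sum.inl j)) ∨
      (p = Sum.inr (Sum.inl j) ∧ q = Sum.inr (Sum.inr j)) ∨
      (p = Sum.inr (Sum.inr j) ∧ q = Sum.inl j.castSucc))

namespace SimpleGraph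

/-- A function vanishing at `w`, `1`-Lipschitz along edges and strictly decreasing along some edge
at every vertex other than `w` is the distance to `w`. -/
theorem reachable_and_dist_eq_of_descent {V : Type*} {G : SimpleGraph V} {w : V} {f : V → ℕ}
    (hw : f w = 0) (lip : ∀ u v, G.Adj u v → f u ≤ f v + 1)
    (desc : ∀ u, u ≠ w → ∃ v, G.Adj u v ∧ f v + 1 = f u) (u : V) :
    G.Reachable u w ∧ G.dist u w = f u := by
  have upper : ∀ m u, f u = m → ∃ p : G.Walk u w, p.length = m := by
    intro m
    induction m with
    | zero =>
      intro u hu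
      by_cases h : u = w
      · subst h
        exact ⟨Walk.nil, rfl⟩
      · obtain ⟨v, -, hv⟩ := desc u h
        omega
    | succ m ih =>
      intro u hu
      have h : u ≠ w := by
        rintro rfl
        omega
      obtain ⟨v, hv, hfv⟩ := desc u h
      obtain ⟨p, hp⟩ := ih v (by omega)
      exact ⟨Walk.cons hv p, by simp [hp]⟩
  have lower : ∀ u v (p : G.Walk u v), f u ≤ f v + p.length := by
    intro u v p
    induction p with
    | nil => simp
    | cons h p ih =>
      have := lip _ _ h
      simp only [Walk.length_cons]
      omega
  obtain ⟨p, hp⟩ := upper _ u rfl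
  refine ⟨⟨p⟩, le_antisymm (hp ▸ dist_le p) ?_⟩
  obtain ⟨q, hq⟩ := (Walk.reachable p).exists_walk_length_eq_dist
  have := lower _ _ q
  omega

end SimpleGraph

namespace orthoChainSquare

variable {n : ℕ}

theorem adj_inl_inl (a b : Fin (n + 1)) :
    (orthoChainSquare n).Adj (.inl a) (.inl b) ↔ a.val + 1 = b.val ∨ b.val + 1 = a.val := by
  simp only [orthoChainSquare, SimpleGraph.fromRel_adj, ne_eq, Sum.inl.injEq, reduceCtorEq,
    and_false, false_and, or_false, Fin.ext_iff, Fin.val_castSucc, Fin.val_succ]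
  constructor
  · rintro ⟨-, ⟨j, h⟩ | ⟨j, h⟩⟩ <;> omega
  · rintro (h | h)
    · exact ⟨by omega, .inl ⟨⟨a, by omega⟩, rfl, h.symm⟩⟩
    · exact ⟨by omega, .inr ⟨⟨b, by omega⟩, rfl, h.symm⟩⟩

theorem adj_inl_r (a : Fin (n + 1)) (j : Fin n) :
    (orthoChainSquare n).Adj (.inl a) (.inr (.inl j)) ↔ a.val = j.val + 1 := by
  simp [orthoChainSquare, SimpleGraph.fromRel_adj, Fin.ext_iff]
  constructor
  · rintro ⟨i, h, h'⟩
    omega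
  · intro h
    exact ⟨j, h, rfl⟩

theorem adj_inl_s (a : Fin (n + 1)) (j : Fin n) :
    (orthoChainSquare n).Adj (.inl a) (.inr (.inr j)) ↔ a.val = j.val := by
  simp [orthoChainSquare, SimpleGraph.fromRel_adj, Fin.ext_iff]
  constructor
  · rintro ⟨i, h, h'⟩
    omega
  · intro h
    exact ⟨j, rfl, h⟩

theorem adj_r_s (i j : Fin n) :
    (orthoChainSquare n).Adj (.inr (.inl i)) (.inr (.inr j)) ↔ i = j := by
  simp [orthoChainSquare, SimpleGraph.fromRel_adj, Fin.ext_iff]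
  constructor
  · rintro ⟨i, h, h'⟩
    omega
  · intro h
    exact ⟨j, h, rfl⟩

theorem not_adj_r_r (i j : Fin n) :
    ¬ (orthoChainSquare n).Adj (.inr (.inl i)) (.inr (.inl j)) := by
  simp [orthoChainSquare, SimpleGraph.fromRel_adj]

theorem not_adj_s_s (i j : Fin n) :
    ¬ (orthoChainSquare n).Adj (.inr (.inr i)) (.inr (.inr j)) := by
  simp [orthoChainSquare, SimpleGraph.fromRel_adj]

theorem adj_r_inl (a : Fin (n + 1)) (j : Fin n) :
    (orthoChainSquare n).Adj (.inr (.inl j)) (.inl a) ↔ a.val = j.val + 1 := by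
  rw [SimpleGraph.adj_comm, adj_inl_r]

theorem adj_s_inl (a : Fin (n + 1)) (j : Fin n) :
    (orthoChainSquare n).Adj (.inr (.inr j)) (.inl a) ↔ a.val = j.val := by
  rw [SimpleGraph.adj_comm, adj_inl_s]

theorem adj_s_r (i j : Fin n) :
    (orthoChainSquare n).Adj (.inr (.inr j)) (.inr (.inl i)) ↔ i = j := by
  rw [SimpleGraph.adj_comm, adj_r_s]

/-- Position of a vertex along the chain. -/
def pos : Fin (n + 1) ⊕ Fin n ⊕ Fin n → ℕ
  | .inl a => a
  | .inr (.inl j) => j + 1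
  | .inr (.inr j) => j

/-- `0` for the vertices on the chain, and `j + 1` for the two other vertices of square `j`. -/
def leg : Fin (n + 1) ⊕ Fin n ⊕ Fin n → ℕ
  | .inl _ => 0
  | .inr (.inl j) => j + 1
  | .inr (.inr j) => j + 1

/-- Closed form of the distance: the chain embeds isometrically in the product of a path with
a star. -/
def gridDist (u v : Fin (n + 1) ⊕ Fin n ⊕ Fin n) : ℕ :=
  (pos u - pos v) + (pos v - pos u) +
    if leg u = leg v then 0 else (if leg u = 0 then 0 else 1) + (if leg v = 0 then 0 else 1)

theorem gridDist_le_of_adj {u v : Fin (n + 1) ⊕ Fin n ⊕ Fin n}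
    (w : Fin (n + 1) ⊕ Fin n ⊕ Fin n) (h : (orthoChainSquare n).Adj u v) :
    gridDist u w ≤ gridDist v w + 1 := by
  rcases u with a | i | i <;> rcases v with b | j | j <;>
    simp only [adj_inl_inl, adj_inl_r, adj_inl_s, adj_r_s, not_adj_r_r, not_adj_s_s, adj_r_inl,
      adj_s_inl, adj_s_r] at h <;>
    grind [gridDist, pos, leg]

theorem exists_adj_gridDist {u w : Fin (n + 1) ⊕ Fin n ⊕ Fin n} (h : u ≠ w) :
    ∃ v, (orthoChainSquare n).Adj u v ∧ gridDist v w + 1 = gridDist u w := by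
  rcases u with a | i | i
  · rcases lt_trichotomy (pos w) a.val with hw | hw | hw
    · refine ⟨.inl ⟨a - 1, by omega⟩, (adj_inl_inl _ _).2 (by simp only; omega), ?_⟩
      grind [gridDist, pos, leg]
    · rcases w with b | j | j
      · exact absurd (congrArg Sum.inl (Fin.ext hw.symm)) h
      · refine ⟨_, (adj_inl_r _ j).2 hw.symm, ?_⟩
        grind [gridDist, pos, leg]
      · refine ⟨_, (adj_inl_s _ j).2 hw.symm, ?_⟩
        grind [gridDist, pos, leg]
    · have hn : pos w ≤ n := by
        rcases w with b | j | j <;> simp only [pos] <;> omega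
      refine ⟨.inl ⟨a + 1, by omega⟩, (adj_inl_inl _ _).2 (by simp), ?_⟩
      grind [gridDist, pos, leg]
  · by_cases hw : leg w = i + 1
    · refine ⟨_, (adj_r_s i i).2 rfl, ?_⟩
      rcases w with b | j | j
      · simp [leg] at hw
      · exact absurd (congrArg (Sum.inr ∘ Sum.inl) (Fin.ext (by simp only [leg] at hw; omega))) h
      · grind [gridDist, pos, leg]
    · refine ⟨_, (adj_r_inl i.succ i).2 (by simp), ?_⟩
      grind [gridDist, pos, leg]
  · by_cases hw : leg w = i + 1
    · refine ⟨_, (adj_s_r i i).2 rfl, ?_⟩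
      rcases w with b | j | j
      · simp [leg] at hw
      · grind [gridDist, pos, leg]
      · exact absurd (congrArg (Sum.inr ∘ Sum.inr) (Fin.ext (by simp only [leg] at hw; omega))) h
    · refine ⟨_, (adj_s_inl i.castSucc i).2 (by simp), ?_⟩
      grind [gridDist, pos, leg]

theorem reachable_and_dist_eq (u w : Fin (n + 1) ⊕ Fin n ⊕ Fin n) :
    (orthoChainSquare n).Reachable u w ∧ (orthoChainSquare n).dist u w = gridDist u w :=
  SimpleGraph.reachable_and_dist_eq_of_descent (f := fun u => gridDist u w) (by simp [gridDist])
    (fun _ _ => gridDist_le_of_adj w) (fun _ => exists_adj_gridDist) u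

theorem nClose_eq_card (u v : Fin (n + 1) ⊕ Fin n ⊕ Fin n) :
    nClose (orthoChainSquare n) u v = #{w | gridDist w u < gridDist w v} := by
  simp [nClose, reachable_and_dist_eq, Nat.card_eq_fintype_card, Fintype.card_subtype]

theorem card_pos_le (j : Fin n) :
    #{w : Fin (n + 1) ⊕ Fin n ⊕ Fin n | pos w ≤ j} = 3 * j.val + 2 := by
  rw [Finset.card_filter, Fintype.sum_sum_type, Fintype.sum_sum_type]
  simp only [pos, ← Finset.card_filter, Nat.succ_le_iff, ← Nat.lt_succ_iff]
  simp only [Fin.card_filter_val_lt, Nat.succ_eq_add_one]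
  omega

theorem card_lt_pos (j : Fin n) :
    #{w : Fin (n + 1) ⊕ Fin n ⊕ Fin n | j.val < pos w} = 3 * (n - j.val) - 1 := by
  have h := Finset.card_filter_add_card_filter_not (s := univ)
    (fun w : Fin (n + 1) ⊕ Fin n ⊕ Fin n => pos w ≤ j)
  simp only [not_le, card_pos_le, card_univ, Fintype.card_sum, Fintype.card_fin] at h
  omega

theorem card_leg_eq (j : Fin n) :
    #{w : Fin (n + 1) ⊕ Fin n ⊕ Fin n | leg w = j + 1} = 2 := by
  rw [Finset.card_filter, Fintype.sum_sum_type, Fintype.sum_sum_type]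
  simp [leg, Fin.val_inj]

theorem card_leg_ne (j : Fin n) :
    #{w : Fin (n + 1) ⊕ Fin n ⊕ Fin n | leg w ≠ j + 1} = 3 * n - 1 := by
  have h := Finset.card_filter_add_card_filter_not (s := univ)
    (fun w : Fin (n + 1) ⊕ Fin n ⊕ Fin n => leg w = j + 1)
  simp only [card_leg_eq, card_univ, Fintype.card_sum, Fintype.card_fin] at h
  simp only [ne_eq]
  omega

theorem nClose_castSucc_succ (j : Fin n) :
    nClose (orthoChainSquare n) (.inl j.castSucc) (.inl j.succ) = 3 * j.val + 2 := by
  rw [nClose_eq_card, ← card_pos_le j]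
  congr 1
  refine Finset.filter_congr fun w _ => ?_
  grind [gridDist, pos, leg]

theorem nClose_succ_castSucc (j : Fin n) :
    nClose (orthoChainSquare n) (.inl j.succ) (.inl j.castSucc) = 3 * (n - j.val) - 1 := by
  rw [nClose_eq_card, ← card_lt_pos j]
  congr 1
  refine Finset.filter_congr fun w _ => ?_
  grind [gridDist, pos, leg]

theorem nClose_s_r (j : Fin n) :
    nClose (orthoChainSquare n) (.inr (.inr j)) (.inr (.inl j)) = 3 * j.val + 2 := by
  rw [nClose_eq_card, ← card_pos_le j]
  congr 1
  refine Finset.filter_congr fun w _ => ?_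
  grind [gridDist, pos, leg]

theorem nClose_r_s (j : Fin n) :
    nClose (orthoChainSquare n) (.inr (.inl j)) (.inr (.inr j)) = 3 * (n - j.val) - 1 := by
  rw [nClose_eq_card, ← card_lt_pos j]
  congr 1
  refine Finset.filter_congr fun w _ => ?_
  grind [gridDist, pos, leg]

theorem nClose_r_succ (j : Fin n) :
    nClose (orthoChainSquare n) (.inr (.inl j)) (.inl j.succ) = 2 := by
  rw [nClose_eq_card, ← card_leg_eq j]
  congr 1
  refine Finset.filter_congr fun w _ => ?_
  grind [gridDist, pos, leg]

theorem nClose_succ_r (j : Fin n) :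
    nClose (orthoChainSquare n) (.inl j.succ) (.inr (.inl j)) = 3 * n - 1 := by
  rw [nClose_eq_card, ← card_leg_ne j]
  congr 1
  refine Finset.filter_congr fun w _ => ?_
  grind [gridDist, pos, leg]

theorem nClose_s_castSucc (j : Fin n) :
    nClose (orthoChainSquare n) (.inr (.inr j)) (.inl j.castSucc) = 2 := by
  rw [nClose_eq_card, ← card_leg_eq j]
  congr 1
  refine Finset.filter_congr fun w _ => ?_
  grind [gridDist, pos, leg]

theorem nClose_castSucc_s (j : Fin n) :
    nClose (orthoChainSquare n) (.inl j.castSucc) (.inr (.inr j)) = 3 * n - 1 := by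
  rw [nClose_eq_card, ← card_leg_ne j]
  congr 1
  refine Finset.filter_congr fun w _ => ?_
  grind [gridDist, pos, leg]

theorem sum_edgeFinset [Fintype (orthoChainSquare n).edgeSet]
    (f : Sym2 (Fin (n + 1) ⊕ Fin n ⊕ Fin n) → ℝ) :
    ∑ e ∈ (orthoChainSquare n).edgeFinset, f e =
      ∑ j : Fin n, (f s(.inl j.castSucc, .inl j.succ) + f s(.inl j.succ, .inr (.inl j)) +
        f s(.inr (.inl j), .inr (.inr j)) + f s(.inr (.inr j), .inl j.castSucc)) := by
  classical
  have key : (orthoChainSquare n).edgeFinset = univ.biUnion fun j : Fin n =>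
      ({s(.inl j.castSucc, .inl j.succ), s(.inl j.succ, .inr (.inl j)),
        s(.inr (.inl j), .inr (.inr j)), s(.inr (.inr j), .inl j.castSucc)} :
        Finset (Sym2 (Fin (n + 1) ⊕ Fin n ⊕ Fin n))) := by
    ext e
    induction e using Sym2.ind with
    | _ u v =>
      rw [SimpleGraph.mem_edgeFinset, SimpleGraph.mem_edgeSet, orthoChainSquare,
        SimpleGraph.fromRel_adj]
      simp only [mem_biUnion, mem_univ, true_and, mem_insert, mem_singleton, Sym2.eq_iff]
      constructor
      · rintro ⟨-, ⟨j, h⟩ | ⟨j, h⟩⟩ <;> exact ⟨j, by tauto⟩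
      · rintro ⟨j, h⟩
        refine ⟨?_, ?_⟩
        · rintro rfl
          rcases u with a | i | i <;> simp [Fin.ext_iff] at h
          omega
        · rw [← exists_or]
          exact ⟨j, by tauto⟩
  rw [key, sum_biUnion]
  · refine sum_congr rfl fun j _ => ?_
    rw [sum_insert, sum_insert, sum_insert, sum_singleton]
    · ring
    all_goals simp [Fin.ext_iff]
  · intro i _ j _ hij
    rw [ne_eq, Fin.ext_iff] at hij
    simp only [Function.onFun, Finset.disjoint_left]
    intro e he
    simp only [mem_insert, mem_singleton] at he ⊢
    rcases he with rfl | rfl | rfl | rfl <;> simp [Fin.ext_iff] <;> omega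

theorem abcggIndex_eq (n : ℕ) : abcggIndex (orthoChainSquare n) =
    n * √2 + 2 * ∑ j ∈ range n,
      √((3 * (n : ℝ) - 1) / ((3 * (j : ℝ) + 2) * (3 * ((n : ℝ) - j) - 1))) := by
  rw [Finset.sum_range, Finset.mul_sum]
  have hn : (n : ℝ) * √2 = ∑ _j : Fin n, √2 := by simp
  rw [hn, ← sum_add_distrib, abcggIndex]
  classical
  rw [sum_edgeFinset]
  refine sum_congr rfl fun j _ => ?_
  simp only [Sym2.lift_mk, nClose_castSucc_succ, nClose_succ_castSucc, nClose_s_r, nClose_r_s,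
    nClose_r_succ, nClose_succ_r, nClose_s_castSucc, nClose_castSucc_s]
  have hj : j.val + 1 ≤ n := j.isLt
  have hj' : (j.val : ℝ) + 1 ≤ n := by exact_mod_cast hj
  have hj0 : (0 : ℝ) ≤ j.val := by positivity
  have e₁ : ((3 * (n - j.val) - 1 : ℕ) : ℝ) = 3 * ((n : ℝ) - j.val) - 1 := by
    rw [Nat.cast_sub (by omega), Nat.cast_mul, Nat.cast_sub (by omega)]
    norm_num
  have e₂ : ((3 * n - 1 : ℕ) : ℝ) = 3 * (n : ℝ) - 1 := by
    rw [Nat.cast_sub (by omega)]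
    norm_num
  have hpos : (0 : ℝ) < 3 * (n : ℝ) - 1 := by linarith
  have half : √((1 : ℝ) / 2) = √2 / 2 := by
    rw [Real.sqrt_div zero_le_one, Real.sqrt_one, div_eq_div_iff (by positivity) two_ne_zero]
    norm_num
  rw [e₁, e₂]
  push_cast
  have h₁ : (3 * (n : ℝ) - 1 + 2 - 2) / ((3 * (n : ℝ) - 1) * 2) = 1 / 2 := by
    field_simp
    ring
  have h₂ : ((2 : ℝ) + (3 * (n : ℝ) - 1) - 2) / (2 * (3 * (n : ℝ) - 1)) = 1 / 2 := by
    field_simp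
    ring
  have h₃ : (3 * (j.val : ℝ) + 2 + (3 * ((n : ℝ) - j.val) - 1) - 2) = 3 * (n : ℝ) - 1 := by ring
  have h₄ : (3 * ((n : ℝ) - j.val) - 1 + (3 * (j.val : ℝ) + 2) - 2) = 3 * (n : ℝ) - 1 := by ring
  rw [h₁, h₂, h₃, h₄, half, mul_comm (3 * ((n : ℝ) - j.val) - 1)]
  ring

theorem degree_r (j : Fin n) [Fintype ((orthoChainSquare n).neighborSet (.inr (.inl j)))] :
    (orthoChainSquare n).degree (.inr (.inl j)) = 2 := by
  classical
  have h : (orthoChainSquare n).neighborFinset (.inr (.inl j)) =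
      {.inl j.succ, .inr (.inr j)} := by
    ext w
    rw [SimpleGraph.mem_neighborFinset]
    rcases w with a | i | i <;> simp [adj_r_inl, not_adj_r_r, adj_r_s, Fin.ext_iff, eq_comm]
  rw [← SimpleGraph.card_neighborFinset_eq_degree, h]
  simp

theorem degree_s (j : Fin n) [Fintype ((orthoChainSquare n).neighborSet (.inr (.inr j)))] :
    (orthoChainSquare n).degree (.inr (.inr j)) = 2 := by
  classical
  have h : (orthoChainSquare n).neighborFinset (.inr (.inr j)) =
      {.inl j.castSucc, .inr (.inl j)} := by
    ext w
    rw [SimpleGraph.mem_neighborFinset]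
    rcases w with a | i | i <;> simp [adj_s_inl, not_adj_s_s, adj_s_r, Fin.ext_iff]
  rw [← SimpleGraph.card_neighborFinset_eq_degree, h]
  simp

theorem degree_inl (a : Fin (n + 1)) [Fintype ((orthoChainSquare n).neighborSet (.inl a))] :
    (orthoChainSquare n).degree (.inl a) =
      (if a.val < n then 2 else 0) + (if 0 < a.val then 2 else 0) := by
  classical
  have h : (orthoChainSquare n).neighborFinset (.inl a) =
      (if h : a.val < n then {.inl ⟨a + 1, by omega⟩, .inr (.inr ⟨a, h⟩)} else ∅) ∪
      (if h : 0 < a.val then {.inl ⟨a - 1, by omega⟩, .inr (.inl ⟨a - 1, by omega⟩)} else ∅) := by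
    ext w
    rw [SimpleGraph.mem_neighborFinset]
    rcases w with b | i | i <;> split_ifs <;>
      simp [adj_inl_inl, adj_inl_r, adj_inl_s, Fin.ext_iff] <;> omega
  rw [← SimpleGraph.card_neighborFinset_eq_degree, h, card_union_of_disjoint]
  · congr 1 <;> split_ifs <;> simp
  · split_ifs <;> simp [Fin.ext_iff]

theorem abcIndex_add_two (m : ℕ) : abcIndex (orthoChainSquare (m + 2)) =
    (3 * (m : ℝ) + 8) / √2 + m * √6 / 4 := by
  have half (d : ℝ) (hd : d ≠ 0) : √((d + 2 - 2) / (d * 2)) = 1 / √2 := by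
    have e : (d + 2 - 2) / (d * 2) = 1 / 2 := by
      field_simp
      ring
    rw [e, Real.sqrt_div zero_le_one, Real.sqrt_one]
  have half' (d : ℝ) (hd : d ≠ 0) : √((2 + d - 2) / (2 * d)) = 1 / √2 := by
    rw [add_comm, mul_comm, half d hd]
  have hd (a : Fin (m + 2 + 1)) : (((if a.val < m + 2 then 2 else 0) +
      (if 0 < a.val then 2 else 0) : ℕ) : ℝ) ≠ 0 := by
    rw [Nat.cast_ne_zero]
    grind
  have quarter : √((4 + 4 - 2) / (4 * 4) : ℝ) = √6 / 4 := by
    rw [Real.sqrt_div (by norm_num), Real.sqrt_mul_self (by norm_num)]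
    norm_num
  rw [abcIndex]
  classical
  rw [sum_edgeFinset]
  simp only [Sym2.lift_mk, degree_r, degree_s, degree_inl]
  simp only [Nat.cast_ofNat, half _ (hd _), half' _ (hd _), half 2 two_ne_zero]
  simp only [sum_add_distrib, sum_const, card_univ, Fintype.card_fin, nsmul_eq_mul]
  rw [Fin.sum_univ_succ, Fin.sum_univ_castSucc]
  have mid (i : Fin m) : i.val + 1 < m + 2 := by omega
  simp [mid]
  norm_num
  field_simp
  ring

end orthoChainSquare

theorem sum_range_two_mul_of_symm (k : ℕ) (f : ℕ → ℝ) (hf : ∀ j < k, f (2 * k - 1 - j) = f j) :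
    ∑ j ∈ range (2 * k), f j = 2 * ∑ j ∈ range k, f j := by
  have h : ∑ j ∈ range k, f (k + j) = ∑ j ∈ range k, f j := by
    rw [← sum_range_reflect]
    refine sum_congr rfl fun j hj => ?_
    rw [mem_range] at hj
    rw [← hf j hj]
    congr 1
    omega
  rw [two_mul k, sum_range_add, h, two_mul]

theorem sum_range_two_mul_add_one_of_symm (k : ℕ) (f : ℕ → ℝ)
    (hf : ∀ j < k, f (2 * k - j) = f j) :
    ∑ j ∈ range (2 * k + 1), f j = 2 * ∑ j ∈ range k, f j + f k := by
  have h : ∑ j ∈ range k, f (k + (j + 1)) = ∑ j ∈ range k, f j := by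
    rw [← sum_range_reflect]
    refine sum_congr rfl fun j hj => ?_
    rw [mem_range] at hj
    rw [← hf j hj]
    congr 1
    omega
  rw [two_mul k, add_assoc, sum_range_add, sum_range_succ', h]
  simp only [add_zero]
  ring

theorem orthoChainSquare_indices (n : ℕ) :
    (∀ k : ℕ, 1 ≤ k →
      (n = 2 * k →
        abcggIndex (orthoChainSquare n) =
          2 * (k : ℝ) * Real.sqrt 2 +
          4 * ∑ i ∈ Finset.Icc 1 k,
            Real.sqrt ((6 * (k : ℝ) - 1) /
              ((6 * (k : ℝ) - 3 * (i : ℝ) + 2) * (3 * (i : ℝ) - 1)))) ∧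
      (n = 2 * k + 1 →
        abcggIndex (orthoChainSquare n) =
          (2 * (k : ℝ) + 1) * Real.sqrt 2 +
          2 * Real.sqrt (6 * (k : ℝ) + 2) / (3 * (k : ℝ) + 2) +
          4 * ∑ i ∈ Finset.Icc 1 k,
            Real.sqrt ((6 * (k : ℝ) + 2) /
              ((6 * (k : ℝ) - 3 * (i : ℝ) + 5) * (3 * (i : ℝ) - 1))))) ∧
    (2 ≤ n →
      abcIndex (orthoChainSquare n) =
        (3 * (n : ℝ) + 2) / Real.sqrt 2 + ((n : ℝ) - 2) * Real.sqrt 6 / 4) := by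
  have reindex (k : ℕ) (f : ℕ → ℝ) : ∑ i ∈ Icc 1 k, f i = ∑ j ∈ range k, f (j + 1) := by
    rw [range_eq_Ico, sum_Ico_add' f 0 k 1]
    rfl
  refine ⟨fun k _ => ⟨?_, ?_⟩, fun hn => ?_⟩
  · rintro rfl
    rw [orthoChainSquare.abcggIndex_eq, sum_range_two_mul_of_symm, reindex]
    · rw [← mul_assoc]
      norm_num only [Nat.cast_mul, Nat.cast_ofNat]
      congr 2
      refine sum_congr rfl fun j _ => ?_
      push_cast
      congr 2 <;> ring
    · intro j hj
      have e : ((2 * k - 1 - j : ℕ) : ℝ) = 2 * k - 1 - j := by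
        rw [Nat.cast_sub (by omega), Nat.cast_sub (by omega)]
        norm_num
      rw [e]
      push_cast
      congr 2
      ring
  · rintro rfl
    rw [orthoChainSquare.abcggIndex_eq, sum_range_two_mul_add_one_of_symm, reindex]
    · have hs : √((3 * ((2 * k + 1 : ℕ) : ℝ) - 1) /
          ((3 * (k : ℝ) + 2) * (3 * (((2 * k + 1 : ℕ) : ℝ) - k) - 1))) =
          √(6 * (k : ℝ) + 2) / (3 * (k : ℝ) + 2) := by
        have e : (3 * ((2 * k + 1 : ℕ) : ℝ) - 1) /
            ((3 * (k : ℝ) + 2) * (3 * (((2 * k + 1 : ℕ) : ℝ) - k) - 1)) =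
            (6 * (k : ℝ) + 2) / ((3 * (k : ℝ) + 2) * (3 * (k : ℝ) + 2)) := by
          push_cast
          congr 1 <;> ring
        rw [e, Real.sqrt_div (by positivity), Real.sqrt_mul_self (by positivity)]
      have hc : ∑ j ∈ range k, √((3 * ((2 * k + 1 : ℕ) : ℝ) - 1) /
          ((3 * (j : ℝ) + 2) * (3 * (((2 * k + 1 : ℕ) : ℝ) - j) - 1))) =
          ∑ j ∈ range k, √((6 * (k : ℝ) + 2) /
            ((6 * (k : ℝ) - 3 * ((j + 1 : ℕ) : ℝ) + 5) * (3 * ((j + 1 : ℕ) : ℝ) - 1))) := by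
        refine sum_congr rfl fun j _ => ?_
        push_cast
        congr 2 <;> ring
      rw [hs, hc]
      push_cast
      ring
    · intro j hj
      have e : ((2 * k - j : ℕ) : ℝ) = 2 * k - j := by
        rw [Nat.cast_sub (by omega)]
        norm_num
      rw [e]
      push_cast
      congr 2
      ring
  · obtain ⟨m, rfl⟩ := Nat.exists_eq_add_of_le' hn
    rw [orthoChainSquare.abcIndex_add_two]
    push_cast
    ring
end
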